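/- For any centrally symmetric convex body K in ℝ² (in particular any Minkowski ball D_p), there exists a centrally symmetric convex hexagon inscribed in K whose area is at least (3√3)/(2π) times the area of K. -/

import Mathlib

open Real MeasureTheory

/-- The determinant of two plane vectors. -/
def dt (a b : ℝ × ℝ) : ℝ := a.1 * b.2 - a.2 * b.1

noncomputable def lin2 (a b : ℝ × ℝ) : (ℝ × ℝ) →ₗ[ℝ] (ℝ × ℝ) :=
  Matrix.toLin (Module.Basis.finTwoProd ℝ) (Module.Basis.finTwoProd ℝ) !![a.1, b.1; a.2, b.2]

lemma lin2_apply (a b p : ℝ × ℝ) : lin2 a b p = p.1 • a + p.2 • b := by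
  unfold lin2
  rw [Matrix.toLin_finTwoProd_apply]
  ext <;> simp <;> ring

lemma lin2_det (a b : ℝ × ℝ) : LinearMap.det (lin2 a b) = dt a b := by
  unfold lin2 dt
  rw [LinearMap.det_toLin, Matrix.det_fin_two_of]; ring

/-- Parallelogram bound. -/
lemma para_bound (H : Set (ℝ × ℝ)) (hH : Convex ℝ H) (a b : ℝ × ℝ) (ha : a ∈ H) (hb : b ∈ H)
    (ha' : -a ∈ H) (hb' : -b ∈ H) : ENNReal.ofReal (2 * |dt a b|) ≤ volume H := by
  set u : ℝ × ℝ := (1 / 2 : ℝ) • (a + b) with hu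
  set v : ℝ × ℝ := (1 / 2 : ℝ) • (a - b) with hv
  have hsub : lin2 u v '' (Set.Ioo (-1 : ℝ) 1 ×ˢ Set.Ioo (-1 : ℝ) 1) ⊆ H := by
    rintro _ ⟨⟨x, y⟩, ⟨⟨hx1, hx2⟩, ⟨hy1, hy2⟩⟩, rfl⟩
    simp only at hx1 hx2 hy1 hy2
    have h1 : ((1 + y) / 2) • a + ((1 - y) / 2) • b ∈ H :=
      hH ha hb (by linarith) (by linarith) (by ring)
    have h2 : ((1 - y) / 2) • (-a) + ((1 + y) / 2) • (-b) ∈ H :=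
      hH ha' hb' (by linarith) (by linarith) (by ring)
    have h3 := hH h1 h2 (a := (1 + x) / 2) (b := (1 - x) / 2) (by linarith) (by linarith) (by ring)
    convert h3 using 1
    rw [lin2_apply, hu, hv]
    ext <;> simp <;> ring
  refine le_trans ?_ (measure_mono hsub)
  rw [Measure.addHaar_image_linearMap, lin2_det, Measure.volume_eq_prod, Measure.prod_prod,
    Real.volume_Ioo, ← ENNReal.ofReal_mul (by norm_num), ← ENNReal.ofReal_mul (abs_nonneg _)]
  apply ENNReal.ofReal_le_ofReal
  have : dt u v = -(1 / 2) * dt a b := by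
    rw [hu, hv]; simp [dt]; ring
  rw [this, abs_mul]
  norm_num
  linarith [abs_nonneg (dt a b)]

def tri (a b : ℝ × ℝ) : Set (ℝ × ℝ) :=
  {p | 0 < dt p b ∧ 0 < dt a p ∧ dt p b + dt a p < dt a b}

lemma tri_meas (a b : ℝ × ℝ) : MeasurableSet (tri a b) := by
  apply IsOpen.measurableSet
  unfold tri dt
  simp only [Set.ofPred_and]
  refine IsOpen.inter ?_ (IsOpen.inter ?_ ?_)
  · exact isOpen_lt (by fun_prop) (by fun_prop)
  · exact isOpen_lt (by fun_prop) (by fun_prop)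
  · exact isOpen_lt (by fun_prop) (by fun_prop)

lemma std_tri : ENNReal.ofReal (1 / 2) =
    volume (regionBetween (fun _ : ℝ => (0 : ℝ)) (fun x => 1 - x) (Set.Ioc 0 1)) := by
  rw [Measure.volume_eq_prod, volume_regionBetween_eq_integral (μ := volume)]
  · congr 1
    rw [← intervalIntegral.integral_of_le (by norm_num)]
    simp only [Pi.sub_apply, sub_zero]
    rw [intervalIntegral.integral_sub (by simp) (by simp)]
    norm_num
  · simp
  · exact (Continuous.integrableOn_Ioc (by fun_prop))
  · exact measurableSet_Ioc
  · intro x hx; simp; exact hx.2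

lemma tri_vol (a b : ℝ × ℝ) (h : 0 < dt a b) :
    ENNReal.ofReal (dt a b / 2) ≤ volume (tri a b) := by
  have hsub : lin2 a b '' (regionBetween (fun _ : ℝ => (0 : ℝ)) (fun x => 1 - x) (Set.Ioc 0 1))
      ⊆ tri a b := by
    rintro _ ⟨⟨x, y⟩, ⟨⟨hx1, hx2⟩, ⟨hy1, hy2⟩⟩, rfl⟩
    simp only at hx1 hx2 hy1 hy2
    rw [lin2_apply]
    have e1 : dt (x • a + y • b) b = x * dt a b := by simp [dt]; ring
    have e2 : dt a (x • a + y • b) = y * dt a b := by simp [dt]; ring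
    simp only [tri, Set.mem_ofPred_eq, e1, e2]
    refine ⟨by positivity, by positivity, by nlinarith⟩
  refine le_trans ?_ (measure_mono hsub)
  rw [Measure.addHaar_image_linearMap, lin2_det, ← std_tri, ← ENNReal.ofReal_mul (abs_nonneg _),
    abs_of_pos h]
  apply ENNReal.ofReal_le_ofReal
  linarith

lemma tri_sub (H : Set (ℝ × ℝ)) (hH : Convex ℝ H) (h0 : (0 : ℝ × ℝ) ∈ H) (a b : ℝ × ℝ)
    (ha : a ∈ H) (hb : b ∈ H) : tri a b ⊆ H := by
  rintro p ⟨h1, h2, h3⟩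
  have hD : 0 < dt a b := by linarith
  have key : p = (dt p b / dt a b) • a + (dt a p / dt a b) • b := by
    have hne := hD.ne'
    ext
    · simp; field_simp; simp only [dt]; ring
    · simp; field_simp; simp only [dt]; ring
  set s := dt p b / dt a b
  set t := dt a p / dt a b
  have hs : 0 < s := div_pos h1 hD
  have ht : 0 < t := div_pos h2 hD
  have hst : s + t < 1 := by
    have : s + t = (dt p b + dt a p) / dt a b := by simp only [s, t]; ring
    rw [this, div_lt_one hD]; exact h3
  have hq := hH ha hb (a := s / (s + t)) (b := t / (s + t)) (by positivity) (by positivity)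
    (by field_simp)
  have hr := hH hq h0 (a := s + t) (b := 1 - (s + t)) (by positivity) (by linarith) (by ring)
  convert hr using 1
  rw [key]
  have : s + t ≠ 0 := by positivity
  ext
  · simp; field_simp
  · simp; field_simp

lemma hex_bound (H : Set (ℝ × ℝ)) (hH : Convex ℝ H) (a b c : ℝ × ℝ)
    (ha : a ∈ H) (hb : b ∈ H) (hc : c ∈ H)
    (ha' : -a ∈ H) (hb' : -b ∈ H) (hc' : -c ∈ H) :
    ENNReal.ofReal (dt a b + dt b c + dt a c) ≤ volume H := by
  have pab := para_bound H hH a b ha hb ha' hb'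
  have pbc := para_bound H hH b c hb hc hb' hc'
  have pac := para_bound H hH a c ha hc ha' hc'
  have two : ∀ u v w : ℝ, u ≤ 0 → ENNReal.ofReal (2 * |v|) ≤ volume H →
      ENNReal.ofReal (2 * |w|) ≤ volume H → ENNReal.ofReal (u + v + w) ≤ volume H := by
    intro u v w hu hv hw
    rcases le_total v w with h | h
    · exact le_trans (ENNReal.ofReal_le_ofReal (by linarith [le_abs_self w])) hw
    · exact le_trans (ENNReal.ofReal_le_ofReal (by linarith [le_abs_self v])) hv
  rcases le_or_gt (dt a b) 0 with h1 | h1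
  · exact two _ _ _ h1 pbc pac
  rcases le_or_gt (dt b c) 0 with h2 | h2
  · have := two _ _ _ h2 pab pac
    rwa [add_comm (dt b c)] at this
  rcases le_or_gt (dt a c) 0 with h3 | h3
  · have := two _ _ _ h3 pab pbc
    rwa [add_assoc, add_comm (dt a c)] at this
  have h0 : (0 : ℝ × ℝ) ∈ H := by
    have := hH ha ha' (a := 1 / 2) (b := 1 / 2) (by norm_num) (by norm_num) (by norm_num)
    simpa using this
  have h3' : dt c (-a) = dt a c := by simp [dt]; ring
  set U := tri a b ∪ tri b c ∪ tri c (-a) with hU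
  have hUm : MeasurableSet U := ((tri_meas _ _).union (tri_meas _ _)).union (tri_meas _ _)
  have hUvol : ENNReal.ofReal ((dt a b + dt b c + dt a c) / 2) ≤ volume U := by
    rw [hU, measure_union, measure_union]
    · have e : (dt a b + dt b c + dt a c) / 2 = dt a b / 2 + dt b c / 2 + dt c (-a) / 2 := by
        rw [h3']; ring
      rw [e, ENNReal.ofReal_add (by positivity) (by rw [h3']; positivity),
        ENNReal.ofReal_add (by positivity) (by positivity)]
      exact add_le_add (add_le_add (tri_vol _ _ h1) (tri_vol _ _ h2))
        (tri_vol _ _ (by rw [h3']; exact h3))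
    · rw [Set.disjoint_left]
      rintro p ⟨q1, q2, -⟩ ⟨r1, r2, -⟩
      simp only [dt] at *; linarith
    · exact tri_meas _ _
    · rw [Set.disjoint_left]
      rintro p (⟨q1, q2, -⟩ | ⟨q1, q2, -⟩) ⟨r1, r2, -⟩
      · have e : dt c p * dt a b = - (dt p b * dt a c + dt a p * dt b c) := by
          simp only [dt]; ring
        have : 0 < dt c p * dt a b := by positivity
        have : 0 < dt p b * dt a c := by positivity
        have : 0 < dt a p * dt b c := by positivity
        linarith
      · simp only [dt] at *; linarith
    · exact tri_meas _ _
  have hUpos : ∀ p ∈ U, 0 < dt a p := by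
    rintro p ((⟨q1, q2, -⟩ | ⟨q1, q2, -⟩) | ⟨q1, q2, -⟩)
    · exact q2
    · have e : dt b c * dt a p = dt p c * dt a b + dt b p * dt a c := by
        simp only [dt]; ring
      have : 0 < dt p c * dt a b := by positivity
      have : 0 < dt b p * dt a c := by positivity
      exact pos_of_mul_pos_right (a := dt b c) (by linarith) h2.le
    · simp [dt] at q1 ⊢; linarith
  have hUH : U ⊆ H := Set.union_subset (Set.union_subset (tri_sub H hH h0 _ _ ha hb)
    (tri_sub H hH h0 _ _ hb hc)) (tri_sub H hH h0 _ _ hc ha')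
  have hnegH : (-U) ⊆ H := by
    have hH' : Convex ℝ (-H) := hH.neg
    have : U ⊆ -H := Set.union_subset (Set.union_subset
      (tri_sub _ hH' (by simpa using h0) _ _ (by simpa using ha') (by simpa using hb'))
      (tri_sub _ hH' (by simpa using h0) _ _ (by simpa using hb') (by simpa using hc')))
      (tri_sub _ hH' (by simpa using h0) _ _ (by simpa using hc') (by simpa using ha))
    intro p hp
    have := this hp
    simpa using this
  have hdis : Disjoint U (-U) := by
    rw [Set.disjoint_left]
    intro p hp hp'
    have g1 := hUpos p hp
    have g2 := hUpos (-p) hp'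
    simp [dt] at g1 g2; linarith
  calc ENNReal.ofReal (dt a b + dt b c + dt a c)
      = ENNReal.ofReal ((dt a b + dt b c + dt a c) / 2)
        + ENNReal.ofReal ((dt a b + dt b c + dt a c) / 2) := by
        rw [← ENNReal.ofReal_add (by positivity) (by positivity)]; congr 1; ring
    _ ≤ volume U + volume (-U) := by
        rw [Measure.measure_neg]; exact add_le_add hUvol hUvol
    _ = volume (U ∪ -U) := (measure_union hdis hUm.neg).symm
    _ ≤ volume H := measure_mono (Set.union_subset hUH hnegH)

lemma cos_sums (t : ℝ) : cos (t + π / 3) + cos (t + 2 * π / 3) = - √3 * sin t ∧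
    cos t - cos (t + 2 * π / 3) = √3 * sin (t + π / 3) ∧
    cos t + cos (t + π / 3) = √3 * sin (t + 2 * π / 3) := by
  have h2 : 2 * π / 3 = π - π / 3 := by ring
  have h3 : (√3) ^ 2 = 3 := Real.sq_sqrt (by norm_num)
  simp only [cos_add, sin_add, h2, cos_sub, sin_sub, cos_pi, sin_pi, cos_pi_div_three,
    sin_pi_div_three]
  refine ⟨by ring, ?_, ?_⟩ <;> ring_nf <;> rw [h3] <;> ring

theorem sas_inequality_symmetric (K : Set (ℝ × ℝ)) (hconv : Convex ℝ K)
    (hcomp : IsCompact K) (hint : (interior K).Nonempty)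
    (hsymm : ∀ x ∈ K, -x ∈ K) :
    ∃ a b c : ℝ × ℝ, a ∈ frontier K ∧ b ∈ frontier K ∧ c ∈ frontier K ∧
      ENNReal.ofReal (3 * Real.sqrt 3 / (2 * π)) * volume K ≤
        volume (convexHull ℝ ({a, b, c, -a, -b, -c} : Set (ℝ × ℝ))) := by
  have hcl := hcomp.isClosed
  obtain ⟨z, hz⟩ := hint
  have hzK := interior_subset hz
  obtain ⟨p, hpK, hp⟩ := hcomp.exists_isMaxOn ⟨z, hzK⟩ (continuous_fst.continuousOn)
  set M := p.1 with hM
  have hpM : ∀ q ∈ K, q.1 ≤ M := fun q hq => hp hq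
  have hpm : ∀ q ∈ K, -M ≤ q.1 := fun q hq => by
    have := hpM _ (hsymm q hq); simp at this; linarith
  -- moving a little from an interior point
  have move : ∀ (q v : ℝ × ℝ), q ∈ interior K → ∃ e > 0, q + (e : ℝ) • v ∈ K := by
    intro q v hq
    have hc : Filter.Tendsto (fun e : ℝ => q + e • v) (nhdsWithin 0 (Set.Ioi 0)) (nhds q) := by
      have : Continuous (fun e : ℝ => q + e • v) := by fun_prop
      have h := this.tendsto 0
      simp only [zero_smul, add_zero] at h
      exact h.mono_left nhdsWithin_le_nhds
    have h1 := hc.eventually (mem_interior_iff_mem_nhds.1 hq)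
    obtain ⟨e, he, he'⟩ := (h1.and self_mem_nhdsWithin).exists
    exact ⟨e, he', he⟩
  have hM0 : 0 < M := by
    obtain ⟨e, he, h⟩ := move z (1, 0) hz
    have h1 := hpM _ h
    have h2 := hpm _ hzK
    simp at h1
    linarith
  have hf : ∀ x : ℝ, ∃ y : ℝ, x ∈ Set.Icc (-M) M →
      ((x, y) ∈ K ∧ ∀ y', (x, y') ∈ K → y' ≤ y) := by
    intro x
    by_cases hx : x ∈ Set.Icc (-M) M
    swap
    · exact ⟨0, fun h => absurd h hx⟩
    have hne : (K ∩ {q | q.1 = x}).Nonempty := by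
      refine ⟨((M + x) / (2 * M)) • p + ((M - x) / (2 * M)) • (-p), ?_, ?_⟩
      · refine hconv hpK (hsymm p hpK) ?_ ?_ ?_
        · exact div_nonneg (by linarith [hx.1]) (by linarith)
        · exact div_nonneg (by linarith [hx.2]) (by linarith)
        · field_simp; ring
      · simp [← hM]; field_simp; ring
    have hcc : IsCompact (K ∩ {q | q.1 = x}) :=
      hcomp.inter_right (isClosed_eq continuous_fst continuous_const)
    obtain ⟨q, ⟨hqK, hqx⟩, hq⟩ := hcc.exists_isMaxOn hne (continuous_snd.continuousOn)
    have hqx' : q.1 = x := hqx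
    refine ⟨q.2, fun _ => ⟨?_, ?_⟩⟩
    · rw [← hqx']; exact hqK
    · intro y' hy'
      exact hq (show (x, y') ∈ K ∩ {q | q.1 = x} from ⟨hy', rfl⟩)
  choose f hf using hf
  have hfK : ∀ x ∈ Set.Icc (-M) M, (x, f x) ∈ K := fun x hx => (hf x hx).1
  have hfmax : ∀ x ∈ Set.Icc (-M) M, ∀ y', (x, y') ∈ K → y' ≤ f x := fun x hx => (hf x hx).2
  have hfront : ∀ x ∈ Set.Icc (-M) M, (x, f x) ∈ frontier K := by
    intro x hx
    rw [hcl.frontier_eq]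
    refine ⟨hfK x hx, fun hi => ?_⟩
    obtain ⟨e, he, h⟩ := move _ (0, 1) hi
    have := hfmax x hx (f x + e) (by simpa using h)
    linarith
  have hconc : ConcaveOn ℝ (Set.Icc (-M) M) f := by
    refine ⟨convex_Icc _ _, ?_⟩
    intro x hx y hy s t hs ht hst
    apply hfmax _ (convex_Icc _ _ hx hy hs ht hst)
    have := hconv (hfK x hx) (hfK y hy) hs ht hst
    simpa using this
  have hcont : ContinuousOn f (Set.Ioo (-M) M) := by
    have := hconc.continuousOn_interior
    rwa [interior_Icc] at this
  obtain ⟨B, hB⟩ := hcomp.isBounded.exists_norm_le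
  have hfint' : IntegrableOn f (Set.Ioo (-M) M) := by
    refine IntegrableOn.of_bound (by simp) (hcont.aestronglyMeasurable measurableSet_Ioo) B ?_
    filter_upwards [ae_restrict_mem measurableSet_Ioo] with x hx
    exact le_trans (norm_snd_le (x, f x)) (hB _ (hfK x (Set.Ioo_subset_Icc_self hx)))
  have hfint : IntervalIntegrable f volume (-M) M := by
    rw [intervalIntegrable_iff_integrableOn_Ioo_of_le (by linarith)]; exact hfint'
  have hfneg : IntervalIntegrable (fun x => f (-x)) volume (-M) M := by
    have := hfint.comp_sub_left 0; simpa using this.symm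
  -- volume of K
  set I := ∫ x in (-M)..M, f x with hI
  have hsum : ∀ x ∈ Set.Icc (-M) M, 0 ≤ f x + f (-x) := by
    intro x hx
    have hx' : -x ∈ Set.Icc (-M) M := ⟨by linarith [hx.2], by linarith [hx.1]⟩
    have := hfmax x hx (-(f (-x))) (by simpa using hsymm _ (hfK _ hx'))
    linarith
  have hvol : volume K ≤ ENNReal.ofReal (2 * I) := by
    have e1 : ∫ x in (-M)..M, (f x + f (-x)) = 2 * I := by
      rw [intervalIntegral.integral_add hfint hfneg, intervalIntegral.integral_comp_neg]
      simp [hI]; ring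
    rw [← e1, intervalIntegral.integral_of_le (by linarith), integral_Ioc_eq_integral_Ioo,
      ← integral_Icc_eq_integral_Ioo,
      ofReal_integral_eq_lintegral_ofReal]
    · rw [Measure.volume_eq_prod, Measure.prod_apply hcl.measurableSet,
        ← lintegral_indicator measurableSet_Icc]
      apply lintegral_mono
      intro x
      simp only
      by_cases hx : x ∈ Set.Icc (-M) M
      · rw [Set.indicator_of_mem hx]
        have hx' : -x ∈ Set.Icc (-M) M := ⟨by linarith [hx.2], by linarith [hx.1]⟩
        have : Prod.mk x ⁻¹' K ⊆ Set.Icc (-f (-x)) (f x) := by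
          intro y hy
          refine ⟨?_, hfmax x hx y hy⟩
          have := hfmax (-x) hx' (-y) (by simpa using hsymm _ hy)
          linarith
        refine le_trans (measure_mono this) ?_
        rw [Real.volume_Icc]
        apply ENNReal.ofReal_le_ofReal; linarith
      · rw [Set.indicator_of_notMem hx]
        have : Prod.mk x ⁻¹' K = ∅ := by
          ext y
          simp only [Set.mem_preimage, Set.mem_empty_iff_false, iff_false]
          intro hy
          exact hx ⟨hpm _ hy, hpM _ hy⟩
        rw [this]; simp
    · exact (intervalIntegrable_iff_integrableOn_Icc_of_le (by linarith)).1 (hfint.add hfneg)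
    · filter_upwards [ae_restrict_mem measurableSet_Icc] with x hx
      exact hsum x hx
  -- change of variables
  have hinj : Set.InjOn (fun t => M * cos t) (Set.Ioo 0 π) := by
    intro s hs t ht hst
    exact injOn_cos (Set.Ioo_subset_Icc_self hs) (Set.Ioo_subset_Icc_self ht)
      (mul_left_cancel₀ hM0.ne' hst)
  have himg : (fun t => M * cos t) '' (Set.Ioo 0 π) = Set.Ioo (-M) M := by
    ext x
    constructor
    · rintro ⟨t, ht, rfl⟩
      have h1 : cos t < 1 := by
        have := cos_lt_cos_of_nonneg_of_le_pi le_rfl ht.2.le ht.1; simpa using this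
      have h2 : -1 < cos t := by
        have := cos_lt_cos_of_nonneg_of_le_pi ht.1.le le_rfl ht.2; simpa using this
      constructor <;> simp only <;> nlinarith
    · rintro ⟨h1, h2⟩
      have g1 : -1 < x / M := by rw [lt_div_iff₀ hM0]; linarith
      have g2 : x / M < 1 := by rw [div_lt_iff₀ hM0]; linarith
      refine ⟨arccos (x / M), ⟨arccos_pos.2 g2, ?_⟩, ?_⟩
      · exact lt_of_le_of_ne (arccos_le_pi _) (fun h => by
          have := arccos_eq_pi.1 h; linarith)
      · simp only [cos_arccos g1.le g2.le]; field_simp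
  have hder : ∀ t ∈ Set.Ioo 0 π,
      HasDerivWithinAt (fun t => M * cos t) (M * -sin t) (Set.Ioo 0 π) t := fun t _ =>
    ((hasDerivAt_cos t).const_mul M).hasDerivWithinAt
  have habs : ∀ t ∈ Set.Ioo 0 π, |M * -sin t| • f (M * cos t) = M * (f (M * cos t) * sin t) := by
    intro t ht
    have := sin_pos_of_pos_of_lt_pi ht.1 ht.2
    rw [mul_neg, abs_neg, abs_of_pos (by positivity), smul_eq_mul]; ring
  set g : ℝ → ℝ := fun t => M * (f (M * cos t) * sin t) with hg
  have hgI : ∫ t in (0 : ℝ)..π, g t = I := by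
    rw [hI, intervalIntegral.integral_of_le pi_pos.le, integral_Ioc_eq_integral_Ioo,
      intervalIntegral.integral_of_le (by linarith), integral_Ioc_eq_integral_Ioo, ← himg,
      integral_image_eq_integral_abs_deriv_smul measurableSet_Ioo hder hinj]
    exact (setIntegral_congr_fun measurableSet_Ioo habs).symm
  have hgint : IntervalIntegrable g volume 0 π := by
    rw [intervalIntegrable_iff_integrableOn_Ioo_of_le pi_pos.le]
    have := hfint'
    rw [← himg, integrableOn_image_iff_integrableOn_abs_deriv_smul measurableSet_Ioo hder hinj]
      at this
    exact this.congr_fun habs measurableSet_Ioo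
  have hpi := pi_pos
  have sub : ∀ u v : ℝ, 0 ≤ u → u ≤ v → v ≤ π → IntervalIntegrable g volume u v := by
    intro u v hu huv hv
    apply hgint.mono_set
    rw [Set.uIcc_of_le huv, Set.uIcc_of_le hpi.le]
    exact Set.Icc_subset_Icc hu hv
  have i1 := sub 0 (π / 3) le_rfl (by linarith) (by linarith)
  have i2 := sub (π / 3) (2 * π / 3) (by linarith) (by linarith) (by linarith)
  have i3 := sub (2 * π / 3) π (by linarith) (by linarith) (by linarith)
  have j2 : IntervalIntegrable (fun t => g (t + π / 3)) volume 0 (π / 3) := by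
    have := i2.comp_add_right (π / 3)
    convert this using 1 <;> ring
  have j3 : IntervalIntegrable (fun t => g (t + 2 * π / 3)) volume 0 (π / 3) := by
    have := i3.comp_add_right (2 * π / 3)
    convert this using 1 <;> ring
  set S : ℝ → ℝ := fun t => √3 * (g t + g (t + π / 3) + g (t + 2 * π / 3)) with hS
  have hSint : IntervalIntegrable S volume 0 (π / 3) := ((i1.add j2).add j3).const_mul _
  have hSI : ∫ t in (0 : ℝ)..(π / 3), S t = √3 * I := by
    rw [hS, intervalIntegral.integral_const_mul, intervalIntegral.integral_add (i1.add j2) j3,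
      intervalIntegral.integral_add i1 j2, intervalIntegral.integral_comp_add_right g,
      intervalIntegral.integral_comp_add_right g]
    rw [show (0 : ℝ) + π / 3 = π / 3 by ring, show π / 3 + π / 3 = 2 * π / 3 by ring,
      show (0 : ℝ) + 2 * π / 3 = 2 * π / 3 by ring, show π / 3 + 2 * π / 3 = π by ring,
      intervalIntegral.integral_add_adjacent_intervals i1 i2,
      intervalIntegral.integral_add_adjacent_intervals (i1.trans i2) i3, hgI]
  obtain ⟨t, ht, hSt⟩ : ∃ t ∈ Set.Ioc 0 (π / 3), 3 * √3 / π * I ≤ S t := by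
    have hi : IntegrableOn S (Set.Ioc 0 (π / 3)) :=
      (intervalIntegrable_iff_integrableOn_Ioc_of_le (by linarith)).1 hSint
    obtain ⟨t, ht, h⟩ := exists_setAverage_le (μ := volume) (by simp [hpi]) (by simp) hi
    refine ⟨t, ht, le_trans (le_of_eq ?_) h⟩
    rw [setAverage_eq, ← intervalIntegral.integral_of_le (by linarith), hSI]
    simp [Measure.real, ENNReal.toReal_ofReal (by linarith : 0 ≤ π / 3)]
    field_simp
  have hmem : ∀ s, M * cos s ∈ Set.Icc (-M) M := fun s =>
    ⟨by nlinarith [neg_one_le_cos s], by nlinarith [cos_le_one s]⟩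
  refine ⟨(M * cos t, f (M * cos t)), (M * cos (t + π / 3), f (M * cos (t + π / 3))),
    (M * cos (t + 2 * π / 3), f (M * cos (t + 2 * π / 3))), hfront _ (hmem _), hfront _ (hmem _),
    hfront _ (hmem _), ?_⟩
  refine le_trans ?_ (hex_bound _ (convex_convexHull ℝ _)
    (M * cos t, f (M * cos t)) (M * cos (t + π / 3), f (M * cos (t + π / 3)))
    (M * cos (t + 2 * π / 3), f (M * cos (t + 2 * π / 3)))
    (subset_convexHull ℝ _ (by simp)) (subset_convexHull ℝ _ (by simp))
    (subset_convexHull ℝ _ (by simp)) (subset_convexHull ℝ _ (by simp))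
    (subset_convexHull ℝ _ (by simp)) (subset_convexHull ℝ _ (by simp)))
  refine le_trans (mul_le_mul_right hvol _) ?_
  rw [← ENNReal.ofReal_mul (by positivity)]
  apply ENNReal.ofReal_le_ofReal
  refine le_trans (le_of_eq ?_) (hSt.trans (le_of_eq ?_))
  · field_simp
  · obtain ⟨c1, c2, c3⟩ := cos_sums t
    simp only [hS, hg, dt]
    linear_combination (M * f (M * cos t)) * c1 - (M * f (M * cos (t + π / 3))) * c2
      - (M * f (M * cos (t + 2 * π / 3))) * c3
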